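/- arXiv:2111.05257 — 2 statements merged into one kernel-verified Lean document; each statement's English description precedes it below -/
import Mathlib

section
/- Let (x_t) and (p_t) be the FTRL and OGD iterates produced by the hint-querying algorithm with parameter α ∈ (0,1]. Then for every u ∈ ℝ^d with ‖u‖ ≤ 1, Σ_{t=1}^T [ p_t·(−α‖c_t‖² − ⟨c_t, x_t⟩) + ⟨c_t, x_t − u⟩ ] ≤ (78 + 38·log(1 + σ_{1:T}))/α. -/
open RealInnerProductSpace

/-- Vectors in `ℝ^d` with the Euclidean structure. -/
abbrev Vec (d : ℕ) := EuclideanSpace ℝ (Fin d)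

section FollowTheRegularizedLeader

variable {E : Type*} [NormedAddCommGroup E] [InnerProductSpace ℝ E]

/-- The regularized linear objective minimized by FTRL. -/
noncomputable def ftrlObjective (g : E) (r : ℝ) (y : E) : ℝ := ⟪g, y⟫ + r / 2 * ‖y‖ ^ 2

/-- `x` minimizes the regularized linear objective over the unit ball. -/
def IsFTRLPoint (g : E) (r : ℝ) (x : E) : Prop :=
  ‖x‖ ≤ 1 ∧ ∀ y : E, ‖y‖ ≤ 1 → ftrlObjective g r x ≤ ftrlObjective g r y

lemma isFTRLPoint_zero {r : ℝ} (hr : 0 ≤ r) : IsFTRLPoint (0 : E) r 0 :=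
  ⟨by simp, fun y _ => by 
    simp only [ftrlObjective, inner_zero_left, norm_zero]
    have : 0 ≤ r / 2 * ‖y‖ ^ 2 := by positivity
    linarith⟩

lemma IsFTRLPoint.quadratic_growth {g x y : E} {r : ℝ} (h : IsFTRLPoint g r x) (hy : ‖y‖ ≤ 1) :
    ftrlObjective g r x + r / 4 * ‖x - y‖ ^ 2 ≤ ftrlObjective g r y := by
  have hm : ‖(1 / 2 : ℝ) • (x + y)‖ ≤ 1 := by
    rw [norm_smul, Real.norm_of_nonneg (by norm_num)]
    linarith [norm_add_le x y, h.1]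
  have key := h.2 _ hm
  have hpar := parallelogram_law_with_norm ℝ x y
  simp only [ftrlObjective, norm_smul, inner_smul_right, inner_add_right, mul_pow,
    Real.norm_of_nonneg (show (0 : ℝ) ≤ 1 / 2 by norm_num)] at key ⊢
  have hsq : ‖x + y‖ ^ 2 = 2 * ‖x‖ ^ 2 + 2 * ‖y‖ ^ 2 - ‖x - y‖ ^ 2 := by nlinarith
  rw [hsq] at key
  linarith

lemma IsFTRLPoint.objective_le {g x : E} {r : ℝ} (h : IsFTRLPoint g r x) (hr : 0 ≤ r) :
    ftrlObjective g r x ≤ r / 2 - ‖g‖ := by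
  rcases eq_or_ne g 0 with rfl | hg
  · have := h.2 0 (by simp)
    simp only [ftrlObjective, inner_zero_left, norm_zero] at this ⊢
    linarith
  · have hg' : ‖g‖ ≠ 0 := norm_ne_zero_iff.2 hg
    have hn : ‖(-‖g‖⁻¹) • g‖ = 1 := by
      rw [norm_smul, norm_neg, norm_inv, norm_norm, inv_mul_cancel₀ hg']
    refine (h.2 _ hn.le).trans (le_of_eq ?_)
    rw [ftrlObjective, hn, inner_smul_right, real_inner_self_eq_norm_sq]
    field_simp
    ring

lemma IsFTRLPoint.stability {g c x x' : E} {r r' : ℝ} (h : IsFTRLPoint g r x)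
    (h' : IsFTRLPoint (g + c) r' x') (hr : 0 < r) (hrr' : r ≤ r') :
    ⟪c, x⟫ + ftrlObjective g r x - ftrlObjective (g + c) r' x' ≤ ‖c‖ ^ 2 / r := by
  have hgrow := h.quadratic_growth h'.1
  have hcs : ⟪c, x - x'⟫ ≤ ‖c‖ * ‖x - x'‖ := real_inner_le_norm _ _
  have hyoung : ‖c‖ * ‖x - x'‖ ≤ ‖c‖ ^ 2 / r + r / 4 * ‖x - x'‖ ^ 2 := by
    have : ‖c‖ ^ 2 / r + r / 4 * ‖x - x'‖ ^ 2 - ‖c‖ * ‖x - x'‖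
        = (‖c‖ - r / 2 * ‖x - x'‖) ^ 2 / r := by
      field_simp
      ring
    have : 0 ≤ (‖c‖ - r / 2 * ‖x - x'‖) ^ 2 / r := by positivity
    linarith
  have hsplit : ftrlObjective (g + c) r' x'
      = ftrlObjective g r x' + ⟪c, x'⟫ + (r' - r) / 2 * ‖x'‖ ^ 2 := by
    simp only [ftrlObjective, inner_add_left]
    ring
  have : 0 ≤ (r' - r) / 2 * ‖x'‖ ^ 2 := by
    have := sub_nonneg.2 hrr'
    positivity
  rw [inner_sub_right] at hcs
  linarith

/-- When the unconstrained minimizer lies outside the unit ball, FTRL plays on the sphere. -/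
lemma IsFTRLPoint.eq_of_le_norm {g x : E} {r : ℝ} (h : IsFTRLPoint g r x) (hr : 0 < r)
    (hg : r ≤ ‖g‖) : x = (-‖g‖⁻¹) • g := by
  have hg0 : 0 < ‖g‖ := hr.trans_le hg
  set y := (-‖g‖⁻¹) • g with hy
  have hn : ‖y‖ = 1 := by
    rw [hy, norm_smul, norm_neg, norm_inv, norm_norm, inv_mul_cancel₀ hg0.ne']
  have hgy : g = (-‖g‖) • y := by
    rw [hy, smul_smul, neg_mul_neg, mul_inv_cancel₀ hg0.ne', one_smul]
  have key := h.quadratic_growth hn.le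
  have hobj : ∀ w, ftrlObjective g r w = -‖g‖ * ⟪y, w⟫ + r / 2 * ‖w‖ ^ 2 := fun w => by
    rw [ftrlObjective, show ⟪g, w⟫ = -‖g‖ * ⟪y, w⟫ by
      conv_lhs => rw [hgy]
      rw [real_inner_smul_left]]
  rw [hobj, hobj, real_inner_self_eq_norm_sq, hn] at key
  have hexp := norm_sub_sq_real x y
  rw [hn, real_inner_comm] at hexp
  have hle : ⟪y, x⟫ ≤ 1 := by
    have := real_inner_le_norm y x
    rw [hn] at this
    linarith [h.1]
  have : ‖x - y‖ ^ 2 ≤ 0 := by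
    nlinarith [mul_nonneg (sub_nonneg.2 hg) (sub_nonneg.2 hle)]
  have : ‖x - y‖ = 0 := by nlinarith [norm_nonneg (x - y)]
  exact sub_eq_zero.1 (norm_eq_zero.1 this)

lemma norm_add_le_norm_add_inner_div {g : E} (c : E) (hg : 0 < ‖g‖) :
    ‖g + c‖ ≤ ‖g‖ + ⟪c, g⟫ / ‖g‖ + ‖c‖ ^ 2 / (2 * ‖g‖) := by
  have hsq := norm_add_sq_real g c
  rw [real_inner_comm] at hsq
  have : ‖g‖ + ⟪c, g⟫ / ‖g‖ + ‖c‖ ^ 2 / (2 * ‖g‖) = (‖g‖ ^ 2 + ‖g + c‖ ^ 2) / (2 * ‖g‖) := by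
    rw [hsq]
    field_simp
    ring
  rw [this, le_div_iff₀ (by positivity)]
  nlinarith [sq_nonneg (‖g‖ - ‖g + c‖)]

lemma IsFTRLPoint.regret_step_le {g x : E} {r : ℝ} (c : E) (h : IsFTRLPoint g r x) (hr : 0 < r)
    (hg : r ≤ ‖g‖) : ⟪c, x⟫ + ‖g + c‖ - ‖g‖ ≤ ‖c‖ ^ 2 / (2 * ‖g‖) := by
  have := norm_add_le_norm_add_inner_div c (hr.trans_le hg)
  rw [h.eq_of_le_norm hr hg, inner_smul_right]
  have : -‖g‖⁻¹ * ⟪c, g⟫ = -(⟪c, g⟫ / ‖g‖) := by ring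
  linarith

end FollowTheRegularizedLeader

lemma div_le_log_sub_log {a s : ℝ} (ha : 0 < a) (hs : 0 ≤ s) :
    s / (a + s) ≤ Real.log (a + s) - Real.log a := by
  have h := Real.one_sub_inv_le_log_of_pos (show 0 < (a + s) / a by positivity)
  rw [Real.log_div (by positivity) ha.ne', inv_div] at h
  refine le_trans (le_of_eq ?_) h
  field_simp
  ring

lemma div_sqrt_le_sqrt_sub_sqrt {a s : ℝ} (ha : 1 ≤ a) (hs : 0 ≤ s) (hs1 : s ≤ 1) :
    s / √a ≤ 3 * (√(a + s) - √a) := by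
  have hsa : 0 < √a := Real.sqrt_pos.2 (by linarith)
  have h1 := Real.sq_sqrt (show 0 ≤ a by linarith)
  have h2 := Real.sq_sqrt (show 0 ≤ a + s by linarith)
  have h3 : √a ≤ √(a + s) := Real.sqrt_le_sqrt (by linarith)
  have h4 : √(a + s) ≤ 2 * √a := by
    rw [← abs_of_nonneg (Real.sqrt_nonneg (a + s))]
    exact abs_le_of_sq_le_sq (by nlinarith) (by positivity)
  rw [div_le_iff₀ hsa]
  nlinarith [mul_nonneg (sub_nonneg.2 h3) (sub_nonneg.2 h4)]

/-- Clamping to an interval `[0, D]` does not increase the distance to a point `q` of it. -/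
lemma sq_clamp_sub_le {D q y : ℝ} (hq0 : 0 ≤ q) (hq : q ≤ D) :
    (max 0 (min D y) - q) ^ 2 ≤ (y - q) ^ 2 := by
  rcases le_total D y with h | h
  · rw [min_eq_left h, max_eq_right (hq0.trans hq)]
    nlinarith
  · rw [min_eq_right h]
    rcases le_total 0 y with h' | h'
    · rw [max_eq_right h']
    · rw [max_eq_left h']
      nlinarith

/-- One step of projected gradient descent with step size `l / b`, in potential form; `a` and `b`
are the scalings before and after the step. -/
lemma ogd_step_le {a b l s D p p' q z : ℝ} (ha : 1 ≤ a) (hs : 0 ≤ s) (hs1 : s ≤ 1)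
    (hb : b = a + s) (hl : 0 < l) (hz : z ^ 2 ≤ 4 * s)
    (hp' : p' = max 0 (min D (p - l / b * z))) (hq0 : 0 ≤ q) (hqD : q ≤ D)
    (hp0 : 0 ≤ p) (hp : p ≤ l / √a) (hqa : q ≤ l / √a) :
    (p - q) * z + (p' - q) ^ 2 * b / (2 * l) ≤
      (p - q) ^ 2 * a / (2 * l) + 3 * l * (Real.log b - Real.log a) := by
  have hb0 : 0 < b := by linarith
  have hproj : (p' - q) ^ 2 ≤ (p - l / b * z - q) ^ 2 := hp' ▸ sq_clamp_sub_le hq0 hqD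
  have h1 : (p' - q) ^ 2 * b / (2 * l) ≤ (p - l / b * z - q) ^ 2 * b / (2 * l) := by gcongr
  have h2 : (p - l / b * z - q) ^ 2 * b / (2 * l)
      = (p - q) ^ 2 * b / (2 * l) - (p - q) * z + l * z ^ 2 / (2 * b) := by
    field_simp
    ring
  have h3 : l * z ^ 2 / (2 * b) ≤ 2 * l * (s / b) := by
    have : l * z ^ 2 / (2 * b) ≤ l * (4 * s) / (2 * b) := by gcongr
    refine this.trans (le_of_eq ?_)
    field_simp
    ring
  have hdist : (p - q) ^ 2 ≤ l ^ 2 / a := by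
    have : (p - q) ^ 2 ≤ (l / √a) ^ 2 := sq_le_sq' (by linarith) (by linarith)
    rwa [div_pow, Real.sq_sqrt (by linarith)] at this
  have h4 : (p - q) ^ 2 * s / (2 * l) ≤ l * (s / b) := by
    have hab : l ^ 2 / a ≤ 2 * l ^ 2 / b := by
      rw [div_le_div_iff₀ (by linarith) hb0]
      nlinarith [sq_nonneg l]
    have : (p - q) ^ 2 * s / (2 * l) ≤ (2 * l ^ 2 / b) * s / (2 * l) := by
      gcongr
      exact hdist.trans hab
    refine this.trans (le_of_eq ?_)
    field_simp
  have h5 : (p - q) ^ 2 * b / (2 * l) = (p - q) ^ 2 * a / (2 * l) + (p - q) ^ 2 * s / (2 * l) := by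
    rw [hb]
    ring
  have h6 : s / b ≤ Real.log b - Real.log a := hb ▸ div_le_log_sub_log (by linarith) hs
  nlinarith

section Iterates

open Finset

lemma ftrl_regret_le {E : Type*} [NormedAddCommGroup E] [InnerProductSpace ℝ E] {c x : ℕ → E}
    {N : ℕ} (hc : ∀ t ∈ Icc 1 N, ‖c t‖ ≤ 1)
    (hx : ∀ n ≤ N, IsFTRLPoint (∑ t ∈ Icc 1 n, c t) √(1 + ∑ t ∈ Icc 1 n, ‖c t‖ ^ 2) (x (n + 1)))
    {n : ℕ} (hn : n ≤ N) :
    ∑ t ∈ Icc 1 n, ⟪c t, x t⟫ + ‖∑ t ∈ Icc 1 n, c t‖ ≤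
      7 / 2 * √(1 + ∑ t ∈ Icc 1 n, ‖c t‖ ^ 2) := by
  have hpot : ∑ t ∈ Icc 1 n, ⟪c t, x t⟫ -
      ftrlObjective (∑ t ∈ Icc 1 n, c t) √(1 + ∑ t ∈ Icc 1 n, ‖c t‖ ^ 2) (x (n + 1)) ≤
        3 * (√(1 + ∑ t ∈ Icc 1 n, ‖c t‖ ^ 2) - 1) := by
    induction n with
    | zero =>
      simp only [zero_lt_one, Icc_eq_empty_of_lt, sum_empty, add_zero, Real.sqrt_one,
        ftrlObjective, inner_zero_left]
      nlinarith [sq_nonneg ‖x (0 + 1)‖]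
    | succ n ih =>
      have hcn : ‖c (n + 1)‖ ≤ 1 := hc _ (mem_Icc.2 ⟨by omega, hn⟩)
      have ih := ih (by omega)
      have h := hx n (by omega)
      have h' := hx (n + 1) hn
      simp only [sum_Icc_succ_top (show 1 ≤ n + 1 by omega), ← add_assoc] at h' ⊢
      have ha : 1 ≤ 1 + ∑ t ∈ Icc 1 n, ‖c t‖ ^ 2 := by
        linarith [sum_nonneg fun t (_ : t ∈ Icc 1 n) => sq_nonneg ‖c t‖]
      have hs := sq_nonneg ‖c (n + 1)‖
      have hstab := h.stability h' (Real.sqrt_pos.2 (by linarith))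
        (Real.sqrt_le_sqrt (by linarith))
      have hsqrt := div_sqrt_le_sqrt_sub_sqrt ha hs (pow_le_one₀ (norm_nonneg _) hcn)
      linarith
  have := (hx n hn).objective_le (Real.sqrt_nonneg _)
  linarith

variable {s p z : ℕ → ℝ} {l : ℝ} {N : ℕ}

lemma ogd_mem_Icc (hl : 0 ≤ l) (hp1 : p 1 = 0)
    (hp : ∀ t ∈ Icc 1 N, p (t + 1) = max 0 (min (min 1 (l / √(1 + ∑ i ∈ Icc 1 t, s i)))
      (p t - l / (1 + ∑ i ∈ Icc 1 t, s i) * z t)))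
    {n : ℕ} (hn : n ≤ N) : p (n + 1) ∈ Set.Icc 0 (l / √(1 + ∑ i ∈ Icc 1 n, s i)) := by
  have hD : 0 ≤ l / √(1 + ∑ i ∈ Icc 1 n, s i) := by positivity
  rcases n.eq_zero_or_pos with rfl | hpos
  · simpa only [zero_add, hp1] using ⟨le_rfl, hD⟩
  · rw [hp n (mem_Icc.2 ⟨hpos, hn⟩)]
    exact ⟨le_max_left _ _, max_le hD ((min_le_left _ _).trans (min_le_right _ _))⟩

lemma ogd_regret_le (hs : ∀ t ∈ Icc 1 N, 0 ≤ s t) (hs1 : ∀ t ∈ Icc 1 N, s t ≤ 1)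
    (hz : ∀ t ∈ Icc 1 N, z t ^ 2 ≤ 4 * s t) (hl : 1 ≤ l) (hp1 : p 1 = 0)
    (hp : ∀ t ∈ Icc 1 N, p (t + 1) = max 0 (min (min 1 (l / √(1 + ∑ i ∈ Icc 1 t, s i)))
      (p t - l / (1 + ∑ i ∈ Icc 1 t, s i) * z t)))
    {n : ℕ} (hn : n ≤ N) {q : ℝ} (hq0 : 0 ≤ q)
    (hq : q ≤ min 1 (l / √(1 + ∑ i ∈ Icc 1 n, s i))) :
    ∑ t ∈ Icc 1 n, (p t - q) * z t + (p (n + 1) - q) ^ 2 * (1 + ∑ t ∈ Icc 1 n, s t) / (2 * l) ≤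
      1 + 3 * l * Real.log (1 + ∑ t ∈ Icc 1 n, s t) := by
  induction n with
  | zero =>
    have hq1 : q ≤ 1 := hq.trans (min_le_left _ _)
    simp only [zero_lt_one, Icc_eq_empty_of_lt, sum_empty, add_zero, Real.log_one, hp1, zero_add,
      mul_zero, mul_one]
    rw [div_le_one (by positivity)]
    nlinarith
  | succ n ih =>
    have hmem : n + 1 ∈ Icc 1 N := mem_Icc.2 ⟨by omega, hn⟩
    have hpn := ogd_mem_Icc (by linarith) hp1 hp (show n ≤ N by omega)
    have hstep := hp (n + 1) hmem
    have ha : 1 ≤ 1 + ∑ t ∈ Icc 1 n, s t := by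
      have : 0 ≤ ∑ t ∈ Icc 1 n, s t :=
        sum_nonneg fun t ht => hs t (Icc_subset_Icc_right (by omega) ht)
      linarith
    have hD : l / √(1 + ∑ t ∈ Icc 1 (n + 1), s t) ≤ l / √(1 + ∑ t ∈ Icc 1 n, s t) := by
      have : 0 < √(1 + ∑ t ∈ Icc 1 n, s t) := Real.sqrt_pos.2 (by linarith)
      rw [sum_Icc_succ_top (show 1 ≤ n + 1 by omega)]
      gcongr
      exact le_add_of_nonneg_right (hs _ hmem)
    have ih := ih (by omega) (hq.trans (min_le_min_left _ hD))
    have := ogd_step_le ha (hs _ hmem) (hs1 _ hmem)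
      (show 1 + ∑ t ∈ Icc 1 (n + 1), s t = 1 + ∑ t ∈ Icc 1 n, s t + s (n + 1) by
        rw [sum_Icc_succ_top (by omega), add_assoc])
      (by linarith) (hz _ hmem) hstep hq0 hq hpn.1 hpn.2
      (hq.trans ((min_le_right _ _).trans hD))
    rw [sum_Icc_succ_top (show 1 ≤ n + 1 by omega) fun t => (p t - q) * z t]
    linarith

end Iterates

/-- If the cumulative cost has norm `G` too small for FTRL to have logarithmic regret, some
comparator `q` cancels the worst-case regret bound `W ≤ 7 / 2 * √(1 + σ)`. -/
lemma exists_comparator {α σ G W : ℝ} (hα0 : 0 < α) (hα1 : α ≤ 1) (hσ : 0 ≤ σ)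
    (hW : W ≤ 7 / 2 * √(1 + σ)) (hG : G < √(1 + σ) ∨ 2 * G < α * σ) :
    ∃ q, 0 ≤ q ∧ q ≤ min 1 (10 / α / √(1 + σ)) ∧ (1 - q) * W + q * (G - α * σ) ≤ 11 / α := by
  have hr1 : 1 ≤ √(1 + σ) := Real.one_le_sqrt.2 (by linarith)
  have hrsq := Real.sq_sqrt (show 0 ≤ 1 + σ by linarith)
  set r := √(1 + σ)
  have hα : 1 ≤ 1 / α := (one_le_div hα0).2 hα1
  have h11 : 11 / α = 11 * (1 / α) := by ring
  by_cases h : 2 * G < α * σ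
  · have hασ : 0 ≤ α * σ := by positivity
    rcases le_total 1 (10 / α / r) with hq | hq
    · refine ⟨1, zero_le_one, le_min le_rfl hq, ?_⟩
      linarith
    · have hq0 : 0 ≤ 10 / α / r := by positivity
      refine ⟨10 / α / r, hq0, le_min hq le_rfl, ?_⟩
      have h1 : (1 - 10 / α / r) * W ≤ 7 / 2 * r := by
        nlinarith [mul_le_mul_of_nonneg_left hW (sub_nonneg.2 hq)]
      have h2 : 10 / α / r * (G - α * σ) ≤ 10 / α / r * (-(α * σ) / 2) := by
        gcongr
        linarith
      have h3 : 10 / α / r * (-(α * σ) / 2) = -5 * (r - 1 / r) := by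
        rw [show σ = r ^ 2 - 1 by linarith]
        field_simp
        ring
      have h4 : 1 / r ≤ 1 := (div_le_one (by linarith)).2 hr1
      linarith
  · refine ⟨0, le_rfl, by positivity, ?_⟩
    have hGr : G < r := hG.resolve_right h
    have hr : r ≤ 3 / α := by
      rw [le_div_iff₀ hα0]
      by_contra! hcon
      nlinarith
    have : 3 / α = 3 * (1 / α) := by ring
    linarith

lemma div_two_mul_le_of_le_norm {α σ s G : ℝ} (hα0 : 0 < α) (hα1 : α ≤ 1) (hσ : 0 ≤ σ)
    (hs0 : 0 ≤ s) (hs1 : s ≤ 1) (hG : √(1 + σ) ≤ G) (hGσ : α * σ ≤ 2 * G) :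
    s / (2 * G) ≤ 2 * (1 / α) * (Real.log (1 + σ + s) - Real.log (1 + σ)) := by
  have hG1 : 1 ≤ G := (Real.one_le_sqrt.2 (by linarith)).trans hG
  calc s / (2 * G) ≤ s / (α * (1 + σ + s) / 2) := by
        gcongr
        nlinarith
    _ = 2 * (1 / α) * (s / (1 + σ + s)) := by field_simp
    _ ≤ _ := by
        gcongr
        exact div_le_log_sub_log (by linarith) hs0

/-- Lemma 3.4 (key lemma for Theorem 3.3): for the FTRL iterates `x_t`
and the shrinking-domain OGD iterates `p_t` (with parameter `λ = 10/α` and costs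
`z_t = −α‖c_t‖² − ⟨c_t, x_t⟩`), for every `u` in the unit ball,
`Σ_t [p_t(−α‖c_t‖² − ⟨c_t,x_t⟩) + ⟨c_t, x_t − u⟩] ≤ (78 + 38 log(1+σ_{1:T}))/α`. -/
theorem stmt3 {d T : ℕ} (α : ℝ) (hα0 : 0 < α) (hα1 : α ≤ 1)
    (c x : ℕ → Vec d)
    (hc : ∀ t ∈ Finset.Icc 1 T, ‖c t‖ ≤ 1)
    (hx1 : x 1 = 0)
    (hxball : ∀ t ∈ Finset.Icc 1 T, ‖x (t + 1)‖ ≤ 1)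
    (hxmin : ∀ t ∈ Finset.Icc 1 T, ∀ y : Vec d, ‖y‖ ≤ 1 →
      ⟪(∑ s ∈ Finset.Icc 1 t, c s), x (t + 1)⟫ +
          Real.sqrt (1 + ∑ s ∈ Finset.Icc 1 t, ‖c s‖ ^ 2) / 2 * ‖x (t + 1)‖ ^ 2 ≤
        ⟪(∑ s ∈ Finset.Icc 1 t, c s), y⟫ +
          Real.sqrt (1 + ∑ s ∈ Finset.Icc 1 t, ‖c s‖ ^ 2) / 2 * ‖y‖ ^ 2)
    (z : ℕ → ℝ)
    (hz : ∀ t, z t = -(α * ‖c t‖ ^ 2) - ⟪c t, x t⟫)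
    (p : ℕ → ℝ) (hp1 : p 1 = 0)
    (hp : ∀ t ∈ Finset.Icc 1 T,
      p (t + 1) =
        max 0 (min (min 1 ((10 / α) / Real.sqrt (1 + ∑ s ∈ Finset.Icc 1 t, ‖c s‖ ^ 2)))
          (p t - (10 / α) / (1 + ∑ s ∈ Finset.Icc 1 t, ‖c s‖ ^ 2) * z t)))
    (u : Vec d) (hu : ‖u‖ ≤ 1) :
    ∑ t ∈ Finset.Icc 1 T,
        (p t * (-(α * ‖c t‖ ^ 2) - ⟪c t, x t⟫) + ⟪c t, x t - u⟫) ≤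
      (78 + 38 * Real.log (1 + ∑ s ∈ Finset.Icc 1 T, ‖c s‖ ^ 2)) / α := by
  set l := 10 / α with hl
  set g : ℕ → Vec d := fun n => ∑ s ∈ Finset.Icc 1 n, c s
  set σ : ℕ → ℝ := fun n => ∑ s ∈ Finset.Icc 1 n, ‖c s‖ ^ 2
  have hl1 : 1 ≤ l := (one_le_div hα0).2 (by linarith)
  have hα : 1 ≤ 1 / α := (one_le_div hα0).2 hα1
  have hσ0 : ∀ n, 0 ≤ σ n := fun n => Finset.sum_nonneg fun t _ => sq_nonneg _
  have hx : ∀ n ≤ T, IsFTRLPoint (g n) √(1 + σ n) (x (n + 1)) := fun n hn => by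
    rcases n.eq_zero_or_pos with rfl | hpos
    · simpa [g, hx1] using isFTRLPoint_zero (Real.sqrt_nonneg _)
    · have hmem := Finset.mem_Icc.2 ⟨hpos, hn⟩
      exact ⟨hxball n hmem, hxmin n hmem⟩
  have hxle : ∀ t ∈ Finset.Icc 1 T, ‖x t‖ ≤ 1 := fun t ht => by
    obtain ⟨h1, h2⟩ := Finset.mem_Icc.1 ht
    obtain ⟨n, rfl⟩ := Nat.exists_eq_add_of_le' h1
    exact (hx n (by omega)).1
  have hcx : ∀ t ∈ Finset.Icc 1 T, |⟪c t, x t⟫| ≤ ‖c t‖ := fun t ht =>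
    (abs_real_inner_le_norm _ _).trans (mul_le_of_le_one_right (norm_nonneg _) (hxle t ht))
  have hs1 : ∀ t ∈ Finset.Icc 1 T, ‖c t‖ ^ 2 ≤ 1 := fun t ht =>
    pow_le_one₀ (norm_nonneg _) (hc t ht)
  have hzsq : ∀ t ∈ Finset.Icc 1 T, z t ^ 2 ≤ 4 * ‖c t‖ ^ 2 := fun t ht => by
    have h1 := abs_le.1 (hcx t ht)
    have h2 : α * ‖c t‖ ^ 2 ≤ ‖c t‖ := by
      nlinarith [hc t ht, norm_nonneg (c t), sq_nonneg ‖c t‖]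
    have h3 : 0 ≤ α * ‖c t‖ ^ 2 := by positivity
    rw [show 4 * ‖c t‖ ^ 2 = (2 * ‖c t‖) ^ 2 by ring, hz]
    exact sq_le_sq' (by linarith) (by linarith)
  set A : ℕ → ℝ := fun n => ∑ t ∈ Finset.Icc 1 n, ⟪c t, x t⟫
  set P : ℕ → ℝ := fun n => ∑ t ∈ Finset.Icc 1 n, p t * z t
  have hsumz : ∀ n, ∑ t ∈ Finset.Icc 1 n, z t = -(α * σ n) - A n := fun n => by
    simp only [hz, Finset.sum_sub_distrib, Finset.sum_neg_distrib, ← Finset.mul_sum, σ, A]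
  have hbad : ∀ n ≤ T, (‖g n‖ < √(1 + σ n) ∨ 2 * ‖g n‖ < α * σ n) →
      P n + A n + ‖g n‖ ≤ (12 + 30 * Real.log (1 + σ n)) / α := fun n hn h => by
    obtain ⟨q, hq0, hq, hqle⟩ := exists_comparator hα0 hα1 (hσ0 n) (ftrl_regret_le hc hx hn) h
    have hogd := ogd_regret_le (fun t _ => sq_nonneg ‖c t‖) hs1 hzsq hl1 hp1 hp hn hq0 hq
    have hpos : 0 ≤ (p (n + 1) - q) ^ 2 * (1 + σ n) / (2 * l) := by
      have := hσ0 n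
      positivity
    have hPq : ∑ t ∈ Finset.Icc 1 n, (p t - q) * z t = P n - q * (-(α * σ n) - A n) := by
      simp only [sub_mul, Finset.sum_sub_distrib, ← Finset.mul_sum, hsumz, P]
    rw [hPq] at hogd
    have : (12 + 30 * Real.log (1 + σ n)) / α
        = 1 / α + 11 / α + 3 * l * Real.log (1 + σ n) := by
      rw [hl]
      ring
    change (1 - q) * (A n + ‖g n‖) + q * (‖g n‖ - α * σ n) ≤ 11 / α at hqle
    change _ + (p (n + 1) - q) ^ 2 * (1 + σ n) / (2 * l) ≤ 1 + 3 * l * Real.log (1 + σ n) at hogd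
    linarith
  have hpn : ∀ n ≤ T, 0 ≤ p (n + 1) ∧ p (n + 1) ≤ l / √(1 + σ n) := fun n hn =>
    ogd_mem_Icc (by linarith) hp1 hp hn
  have hsplit : ∑ t ∈ Finset.Icc 1 T, (p t * (-(α * ‖c t‖ ^ 2) - ⟪c t, x t⟫) + ⟪c t, x t - u⟫)
      = P T + A T - ⟪g T, u⟫ := by
    simp only [P, A, g, hz, inner_sub_right, Finset.sum_add_distrib, Finset.sum_sub_distrib,
      sum_inner, add_sub_assoc]
  rw [hsplit]
  change _ ≤ (78 + 38 * Real.log (1 + σ T)) / α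
  have hPs : ∀ n, P (n + 1) = P n + p (n + 1) * z (n + 1) := fun n =>
    Finset.sum_Icc_succ_top (by omega) _
  have hAs : ∀ n, A (n + 1) = A n + ⟪c (n + 1), x (n + 1)⟫ := fun n =>
    Finset.sum_Icc_succ_top (by omega) _
  have hgs : ∀ n, g (n + 1) = g n + c (n + 1) := fun n => Finset.sum_Icc_succ_top (by omega) _
  have hσs : ∀ n, 1 + σ (n + 1) = 1 + σ n + ‖c (n + 1)‖ ^ 2 := fun n => by
    rw [add_assoc]
    exact congrArg _ (Finset.sum_Icc_succ_top (by omega) _)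
  have hp' : ∀ t ∈ Finset.Icc 1 T,
      p (t + 1) = max 0 (min (min 1 (l / √(1 + σ t))) (p t - l / (1 + σ t) * z t)) := hp
  have hP0 : P 0 = 0 := by simp [P]
  have hA0 : A 0 = 0 := by simp [A]
  have hg0 : g 0 = 0 := by simp [g]
  have hσ00 : σ 0 = 0 := by simp [σ]
  clear_value P A g σ
  have hmain : ∀ n ≤ T, P n + A n + ‖g n‖ + p (n + 1) ^ 2 * (1 + σ n) / (2 * l) ≤
      (19 + 32 * Real.log (1 + σ n)) / α := fun n => by
    induction n with
    | zero =>
      intro _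
      simp only [hP0, hA0, hg0, hσ00, hp1, zero_add, norm_zero, add_zero, Real.log_one]
      norm_num
      positivity
    | succ n ih =>
      intro hn
      have ih := ih (by omega)
      have hmem : n + 1 ∈ Finset.Icc 1 T := Finset.mem_Icc.2 ⟨by omega, hn⟩
      have hn' : n ≤ T := by omega
      have ha : 1 ≤ 1 + σ n := by linarith [hσ0 n]
      have hs := sq_nonneg ‖c (n + 1)‖
      have hσs := hσs n
      obtain ⟨hp0, hple⟩ := hpn n hn'
      have hD : 0 ≤ min 1 (l / √(1 + σ (n + 1))) := by positivity
      have hl0 : 0 < l := by linarith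
      have hstep := ogd_step_le ha hs (hs1 _ hmem) hσs hl0 (hzsq _ hmem) (hp' _ hmem)
        le_rfl hD hp0 hple (hp0.trans hple)
      simp only [sub_zero] at hstep
      have hr : 0 < √(1 + σ n) := Real.sqrt_pos.2 (by linarith)
      have hrsq := Real.sq_sqrt (show 0 ≤ 1 + σ n by linarith)
      have hlα : 3 * l = 30 * (1 / α) := by rw [hl]; ring
      rw [hlα] at hstep
      rw [div_eq_mul_one_div (19 + _)] at ih ⊢
      have hlogmono : 0 ≤ Real.log (1 + σ (n + 1)) - Real.log (1 + σ n) :=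
        sub_nonneg.2 (Real.log_le_log (by linarith) (by linarith))
      by_cases h : ‖g n‖ < √(1 + σ n) ∨ 2 * ‖g n‖ < α * σ n
      · have hb := hbad n hn' h
        rw [div_eq_mul_one_div] at hb
        have hinit : p (n + 1) ^ 2 * (1 + σ n) / (2 * l) ≤ 5 * (1 / α) := by
          have hsq : p (n + 1) ^ 2 ≤ (l / √(1 + σ n)) ^ 2 := by gcongr
          rw [div_pow, hrsq, le_div_iff₀ (by linarith)] at hsq
          rw [div_le_iff₀ (by linarith), show 5 * (1 / α) = l / 2 by rw [hl]; ring]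
          linarith
        have hinner := (abs_le.1 (hcx _ hmem)).2
        have htri := norm_add_le (g n) (c (n + 1))
        have hcn := hc _ hmem
        rw [hPs, hAs, hgs]
        have hlog0 := Real.log_nonneg ha
        have h1 : 0 ≤ 1 / α * (Real.log (1 + σ (n + 1)) - Real.log (1 + σ n)) :=
          mul_nonneg (by linarith) hlogmono
        have h2 : 0 ≤ 1 / α * Real.log (1 + σ n) := mul_nonneg (by linarith) hlog0
        linarith
      · push Not at h
        have hreg := (hx n hn').regret_step_le (c (n + 1)) hr h.1
        have hgain := div_two_mul_le_of_le_norm hα0 hα1 (hσ0 n) hs (hs1 _ hmem) h.1 h.2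
        rw [← hσs] at hgain
        rw [hPs, hAs, hgs]
        linarith
  have hgu : -⟪g T, u⟫ ≤ ‖g T‖ :=
    (neg_le_abs _).trans ((abs_real_inner_le_norm _ _).trans
      (mul_le_of_le_one_right (norm_nonneg _) hu))
  have hpot : 0 ≤ p (T + 1) ^ 2 * (1 + σ T) / (2 * l) := by
    have := hσ0 T
    positivity
  have hlog0 : 0 ≤ Real.log (1 + σ T) := Real.log_nonneg (by linarith [hσ0 T])
  have hconst : (19 + 32 * Real.log (1 + σ T)) / α ≤ (78 + 38 * Real.log (1 + σ T)) / α := by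
    gcongr <;> norm_num
  linarith [hmain T le_rfl]
end

section
/- Set α = 1/4 and let 𝓑 = {t ∈ {1,…,T} : ⟨c_t, h_t⟩ < ‖c_t‖²/4}. Then the hint-querying algorithm with parameter α = 1/4 satisfies: sup over ‖u‖ ≤ 1 of Σ_{t=1}^T [ p_t·⟨c_t, −h_t⟩ + (1−p_t)·⟨c_t, x_t⟩ − ⟨c_t, u⟩ ] is at most 312 + 152·log(1 + σ_{1:T}) + 80·(1 + √(log(1 + σ_{1:T})))·√(Σ_{t∈𝓑} ‖c_t − h_t‖²); moreover Σ_{t=1}^T p_t·(1/4)·‖c_t‖² ≤ 20·√(σ_{1:T}). -/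
open RealInnerProductSpace

section FTRL

variable {E : Type*} [NormedAddCommGroup E] [InnerProductSpace ℝ E]

/-- Quadratic growth around the minimizer of a regularized linear function on the unit ball. -/
lemma ftrl_quadratic_growth {C x y : E} {r : ℝ} (hx : ‖x‖ ≤ 1) (hy : ‖y‖ ≤ 1)
    (hmin : ∀ y : E, ‖y‖ ≤ 1 → ⟪C, x⟫ + r / 2 * ‖x‖ ^ 2 ≤ ⟪C, y⟫ + r / 2 * ‖y‖ ^ 2) :
    ⟪C, x⟫ + r / 2 * ‖x‖ ^ 2 + r / 4 * ‖y - x‖ ^ 2 ≤ ⟪C, y⟫ + r / 2 * ‖y‖ ^ 2 := by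
  have hmid : ‖(1 / 2 : ℝ) • (x + y)‖ ≤ 1 := by
    rw [norm_smul, Real.norm_of_nonneg (by norm_num)]
    linarith [norm_add_le x y]
  have h := hmin _ hmid
  rw [norm_smul, Real.norm_of_nonneg (by norm_num), inner_smul_right, inner_add_right, mul_pow,
    norm_add_sq_real] at h
  rw [norm_sub_sq_real, real_inner_comm x y]
  linarith

/-- When the accumulated cost dominates the regularization, the minimizer lies on the sphere. -/
lemma ftrl_eq_neg_normalized {C x : E} {r : ℝ} (hC : 0 < ‖C‖) (hr : r ≤ ‖C‖) (hx : ‖x‖ ≤ 1)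
    (hmin : ∀ y : E, ‖y‖ ≤ 1 → ⟪C, x⟫ + r / 2 * ‖x‖ ^ 2 ≤ ⟪C, y⟫ + r / 2 * ‖y‖ ^ 2) :
    x = -(‖C‖⁻¹ • C) := by
  have hn : ‖‖C‖⁻¹ • C‖ = 1 := by
    rw [norm_smul, norm_inv, norm_norm, inv_mul_cancel₀ hC.ne']
  have h := hmin (-(‖C‖⁻¹ • C)) (by rw [norm_neg, hn])
  rw [norm_neg, hn, inner_neg_right, inner_smul_right, real_inner_self_eq_norm_sq] at h
  have e1 : ‖C‖⁻¹ * ‖C‖ ^ 2 = ‖C‖ := by field_simp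
  have e2 : ‖x + ‖C‖⁻¹ • C‖ ^ 2 = ‖x‖ ^ 2 + 2 * (‖C‖⁻¹ * ⟪C, x⟫) + 1 := by
    rw [norm_add_sq_real, hn, inner_smul_right, real_inner_comm C x]
    ring
  have e3 : ‖C‖ * ‖x + ‖C‖⁻¹ • C‖ ^ 2 = ‖C‖ * ‖x‖ ^ 2 + 2 * ⟪C, x⟫ + ‖C‖ := by
    rw [e2]
    field_simp
  rw [e1] at h
  have hx2 : ‖x‖ ^ 2 ≤ 1 := by nlinarith [norm_nonneg x]
  have h0 : ‖C‖ * ‖x + ‖C‖⁻¹ • C‖ ^ 2 ≤ 0 := by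
    nlinarith [mul_nonneg (sub_nonneg.2 hr) (sub_nonneg.2 hx2)]
  have h1 : ‖x + ‖C‖⁻¹ • C‖ ^ 2 ≤ 0 := by
    by_contra! hlt
    nlinarith [mul_pos hC hlt]
  have h2 : ‖x + ‖C‖⁻¹ • C‖ = 0 := by
    nlinarith [norm_nonneg (x + ‖C‖⁻¹ • C)]
  exact eq_neg_of_add_eq_zero_left (norm_eq_zero.1 h2)

lemma norm_add_le_of_pos {C c : E} (hC : 0 < ‖C‖) :
    ‖C + c‖ ≤ ‖C‖ + ‖C‖⁻¹ * ⟪c, C⟫ + ‖c‖ ^ 2 / (2 * ‖C‖) := by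
  have h := norm_add_sq_real C c
  rw [real_inner_comm c C] at h
  have e : ‖C‖ + ‖C‖⁻¹ * ⟪c, C⟫ + ‖c‖ ^ 2 / (2 * ‖C‖) =
      (‖C‖ ^ 2 + ‖C + c‖ ^ 2) / (2 * ‖C‖) := by
    rw [h]
    field_simp
    ring
  rw [e, le_div_iff₀ (by positivity)]
  nlinarith [sq_nonneg (‖C‖ - ‖C + c‖)]

end FTRL

lemma div_sqrt_one_add_le {a b : ℝ} (ha : 0 ≤ a) (hb : 0 ≤ b) (hb1 : b ≤ 1) :
    b / √(1 + a) ≤ 2 * √(a + b) - 2 * √a := by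
  rw [div_le_iff₀ (Real.sqrt_pos.2 (by linarith))]
  have h1 : √(a + b) ≤ √(1 + a) := Real.sqrt_le_sqrt (by linarith)
  have h2 : √a ≤ √(a + b) := Real.sqrt_le_sqrt (by linarith)
  have h3 := Real.sq_sqrt ha
  have h4 := Real.sq_sqrt (add_nonneg ha hb)
  nlinarith [mul_nonneg (sub_nonneg.2 h2) (sub_nonneg.2 h1),
    mul_nonneg (sub_nonneg.2 h2) (sub_nonneg.2 (h2.trans h1))]

lemma div_add_le_log_sub_log {A a : ℝ} (hA : 0 < A) (ha : 0 ≤ a) :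
    a / (A + a) ≤ Real.log (A + a) - Real.log A := by
  have h := Real.one_sub_inv_le_log_of_pos (x := (A + a) / A) (by positivity)
  rw [Real.log_div (by positivity) hA.ne'] at h
  have e : a / (A + a) = 1 - ((A + a) / A)⁻¹ := by
    have : A + a ≠ 0 := by positivity
    field_simp
    ring
  linarith

/-- One step of projected gradient descent on an interval, with a decreasing step size. -/
lemma ogd_step {p p' z A a q : ℝ} (hA : 1 ≤ A) (ha : 0 ≤ a) (ha1 : a ≤ 1) (hp0 : 0 ≤ p)
    (hpA : p ^ 2 * A ≤ 1600) (hq0 : 0 ≤ q) (hq1 : q ≤ 1) (hqA : q ≤ 40 / √(A + a))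
    (hz : z ^ 2 ≤ 25 / 16 * a)
    (hp' : p' = max 0 (min (min 1 (40 / √(A + a))) (p - 40 / (A + a) * z))) :
    p * z + (p' - q) ^ 2 * (A + a) / 80 ≤
      q * z + (p - q) ^ 2 * A / 80 + 285 / 4 * (a / (A + a)) := by
  have hB : 0 < A + a := by linarith
  have hsq : (p' - q) ^ 2 ≤ (p - 40 / (A + a) * z - q) ^ 2 := by
    rw [sq_le_sq, hp']
    have hqm : q ≤ min 1 (40 / √(A + a)) := le_min hq1 hqA
    generalize min 1 (40 / √(A + a)) = m at *
    generalize p - 40 / (A + a) * z = w at *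
    rcases le_total m w with h | h
    · rw [min_eq_left h, max_eq_right (hq0.trans hqm), abs_of_nonneg (by linarith),
        abs_of_nonneg (by linarith)]
      linarith
    · rw [min_eq_right h]
      rcases le_total 0 w with h0 | h0
      · rw [max_eq_right h0]
      · rw [max_eq_left h0, abs_of_nonpos (by linarith), abs_of_nonpos (by linarith)]
        linarith
  have hq2 : q ^ 2 * A ≤ 1600 := by
    have h1 : q * √(A + a) ≤ 40 := (le_div_iff₀ (Real.sqrt_pos.2 hB)).1 hqA
    have h2 : (q * √(A + a)) ^ 2 ≤ 40 ^ 2 := pow_le_pow_left₀ (by positivity) h1 2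
    rw [mul_pow, Real.sq_sqrt hB.le] at h2
    nlinarith [mul_nonneg (sq_nonneg q) ha]
  have hpq : (p - q) ^ 2 * A ≤ 1600 := by
    rcases le_total p q with h | h
    · have : (p - q) ^ 2 ≤ q ^ 2 := by nlinarith
      exact (mul_le_mul_of_nonneg_right this (by linarith)).trans hq2
    · have : (p - q) ^ 2 ≤ p ^ 2 := by nlinarith
      exact (mul_le_mul_of_nonneg_right this (by linarith)).trans hpA
  have hpqB : (p - q) ^ 2 * a ≤ 3200 * (a / (A + a)) := by
    rw [← mul_div_assoc, le_div_iff₀ hB]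
    have : (p - q) ^ 2 * (A + a) ≤ 3200 := by
      nlinarith [mul_nonneg (sq_nonneg (p - q)) (show 0 ≤ A - a by linarith)]
    nlinarith
  have hzB : z ^ 2 / (A + a) ≤ 25 / 16 * (a / (A + a)) := by
    rw [← mul_div_assoc]
    gcongr
  have hexp : (p - 40 / (A + a) * z - q) ^ 2 * (A + a) =
      (p - q) ^ 2 * (A + a) - 80 * z * (p - q) + 1600 * (z ^ 2 / (A + a)) := by
    field_simp
    ring
  have := mul_le_mul_of_nonneg_right hsq hB.le
  rw [hexp] at this
  linarith

section Regret

variable {E : Type*} [NormedAddCommGroup E] [InnerProductSpace ℝ E]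

/-- The regret of FTRL with adaptive quadratic regularization on the unit ball. -/
lemma ftrl_regret {c x C : ℕ → E} {s : ℕ → ℝ} {T : ℕ} (hs0 : s 0 = 0)
    (hC : ∀ n, C (n + 1) = C n + c (n + 1)) (hs : ∀ n, s (n + 1) = s n + ‖c (n + 1)‖ ^ 2)
    (hsn : ∀ n, 0 ≤ s n) (hc : ∀ n < T, ‖c (n + 1)‖ ≤ 1) (hx : ∀ n ≤ T, ‖x (n + 1)‖ ≤ 1)
    (hx1 : x 1 = 0)
    (hmin : ∀ n ≤ T, ∀ y : E, ‖y‖ ≤ 1 → ⟪C n, x (n + 1)⟫ + √(1 + s n) / 2 * ‖x (n + 1)‖ ^ 2 ≤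
      ⟪C n, y⟫ + √(1 + s n) / 2 * ‖y‖ ^ 2) (n : ℕ) (hn : n ≤ T) :
    ∑ t ∈ Finset.Icc 1 n, ⟪c t, x t⟫ + ‖C n‖ ≤ 5 / 2 * √(1 + s n) := by
  have key : ∀ n ≤ T, ∑ t ∈ Finset.Icc 1 n, ⟪c t, x t⟫ ≤
      ⟪C n, x (n + 1)⟫ + √(1 + s n) / 2 * ‖x (n + 1)‖ ^ 2 + 2 * √(s n) := by
    intro n
    induction n with
    | zero => simp [hx1, hs0]
    | succ n ih =>
      intro hn
      have ih := ih (by omega)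
      rw [Finset.sum_Icc_succ_top (by omega), hC, inner_add_left]
      have hg := ftrl_quadratic_growth (hx n (by omega)) (hx (n + 1) hn) (hmin n (by omega))
      have hc1 : ‖c (n + 1)‖ ^ 2 ≤ 1 := by nlinarith [hc n (by omega), norm_nonneg (c (n + 1))]
      have hd := div_sqrt_one_add_le (hsn n) (sq_nonneg ‖c (n + 1)‖) hc1
      rw [← hs] at hd
      have hmono : √(1 + s n) ≤ √(1 + s (n + 1)) :=
        Real.sqrt_le_sqrt (by rw [hs]; nlinarith [sq_nonneg ‖c (n + 1)‖])
      have hr : 0 < √(1 + s n) := Real.sqrt_pos.2 (by linarith [hsn n])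
      have hcs := neg_le_of_abs_le (abs_real_inner_le_norm (c (n + 1)) (x (n + 1 + 1) - x (n + 1)))
      rw [inner_sub_right] at hcs
      have hyoung : ‖c (n + 1)‖ * ‖x (n + 1 + 1) - x (n + 1)‖ ≤
          ‖c (n + 1)‖ ^ 2 / √(1 + s n) +
            √(1 + s n) / 4 * ‖x (n + 1 + 1) - x (n + 1)‖ ^ 2 := by
        generalize ‖x (n + 1 + 1) - x (n + 1)‖ = b
        generalize ‖c (n + 1)‖ = a
        generalize √(1 + s n) = r at *
        have : a ^ 2 / r + r / 4 * b ^ 2 - a * b = (a - r * b / 2) ^ 2 / r := by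
          field_simp
          ring
        have : 0 ≤ (a - r * b / 2) ^ 2 / r := by positivity
        linarith
      have := mul_le_mul_of_nonneg_right hmono (sq_nonneg ‖x (n + 1 + 1)‖)
      linarith
  have hk := key n hn
  have hm : ⟪C n, x (n + 1)⟫ + √(1 + s n) / 2 * ‖x (n + 1)‖ ^ 2 ≤
      -‖C n‖ + √(1 + s n) / 2 := by
    rcases eq_or_ne (C n) 0 with h0 | h0
    · have := hmin n hn 0 (by simp)
      have hr := Real.sqrt_nonneg (1 + s n)
      simp only [h0, inner_zero_left, norm_zero] at this ⊢
      linarith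
    · have hpos := norm_pos_iff.2 h0
      have hnn : ‖‖C n‖⁻¹ • C n‖ = 1 := by
        rw [norm_smul, norm_inv, norm_norm, inv_mul_cancel₀ hpos.ne']
      have h := hmin n hn (-(‖C n‖⁻¹ • C n)) (by rw [norm_neg, hnn])
      rw [norm_neg, hnn, inner_neg_right, inner_smul_right, real_inner_self_eq_norm_sq] at h
      have e1 : ‖C n‖⁻¹ * ‖C n‖ ^ 2 = ‖C n‖ := by field_simp
      rw [e1] at h
      linarith
  have : √(s n) ≤ √(1 + s n) := Real.sqrt_le_sqrt (by linarith)
  linarith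

/-- The surrogate regret, in which each hint is replaced by its guaranteed correlation, is
logarithmic. -/
lemma surrogate_regret_le {c x C : ℕ → E} {s z p : ℕ → ℝ} {T : ℕ} (hs0 : s 0 = 0)
    (hC : ∀ n, C (n + 1) = C n + c (n + 1)) (hs : ∀ n, s (n + 1) = s n + ‖c (n + 1)‖ ^ 2)
    (hsn : ∀ n, 0 ≤ s n) (hc : ∀ n < T, ‖c (n + 1)‖ ≤ 1) (hx : ∀ n ≤ T, ‖x (n + 1)‖ ≤ 1)
    (hx1 : x 1 = 0)
    (hmin : ∀ n ≤ T, ∀ y : E, ‖y‖ ≤ 1 → ⟪C n, x (n + 1)⟫ + √(1 + s n) / 2 * ‖x (n + 1)‖ ^ 2 ≤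
      ⟪C n, y⟫ + √(1 + s n) / 2 * ‖y‖ ^ 2)
    (hz : ∀ t, z t = -((1 / 4) * ‖c t‖ ^ 2) - ⟪c t, x t⟫) (hp1 : p 1 = 0)
    (hp0 : ∀ n ≤ T, 0 ≤ p (n + 1)) (hpA : ∀ n ≤ T, p (n + 1) ^ 2 * (1 + s n) ≤ 1600)
    (hp : ∀ n < T, p (n + 1 + 1) = max 0 (min (min 1 (40 / √(1 + s (n + 1))))
      (p (n + 1) - 40 / (1 + s (n + 1)) * z (n + 1)))) :
    ∑ t ∈ Finset.Icc 1 T, ⟪c t, x t⟫ + ∑ t ∈ Finset.Icc 1 T, p t * z t + ‖C T‖ ≤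
      43 + 317 / 4 * Real.log (1 + s T) := by
  have hlog : ∀ n, ‖c (n + 1)‖ ^ 2 / (1 + s (n + 1)) ≤
      Real.log (1 + s (n + 1)) - Real.log (1 + s n) := by
    intro n
    have h := div_add_le_log_sub_log (A := 1 + s n) (by linarith [hsn n])
      (sq_nonneg ‖c (n + 1)‖)
    rwa [add_assoc, ← hs] at h
  have hc2 : ∀ n < T, ‖c (n + 1)‖ ^ 2 ≤ 1 := fun n hn => by
    nlinarith [hc n hn, norm_nonneg (c (n + 1))]
  have hcx : ∀ n < T, |⟪c (n + 1), x (n + 1)⟫| ≤ ‖c (n + 1)‖ := fun n hn =>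
    (abs_real_inner_le_norm _ _).trans
      (mul_le_of_le_one_right (norm_nonneg _) (hx n hn.le))
  have hz2 : ∀ n < T, z (n + 1) ^ 2 ≤ 25 / 16 * ‖c (n + 1)‖ ^ 2 := by
    intro n hn
    have h1 := abs_le.1 (hcx n hn)
    have h2 := hc n hn
    have h3 := norm_nonneg (c (n + 1))
    have h4 : |z (n + 1)| ≤ 5 / 4 * ‖c (n + 1)‖ := by
      rw [hz, abs_le]
      constructor <;> nlinarith
    have := sq_le_sq' (neg_le_of_abs_le h4) (le_of_abs_le h4)
    linarith
  have hogd : ∀ n < T, ∀ q, 0 ≤ q → q ≤ 1 → q ≤ 40 / √(1 + s (n + 1)) →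
      p (n + 1) * z (n + 1) + (p (n + 1 + 1) - q) ^ 2 * (1 + s (n + 1)) / 80 ≤
        q * z (n + 1) + (p (n + 1) - q) ^ 2 * (1 + s n) / 80 +
          285 / 4 * (Real.log (1 + s (n + 1)) - Real.log (1 + s n)) := by
    intro n hn q hq0 hq1 hqA
    have e : 1 + s (n + 1) = 1 + s n + ‖c (n + 1)‖ ^ 2 := by rw [hs]; ring
    have h := ogd_step (p' := p (n + 1 + 1)) (A := 1 + s n) (a := ‖c (n + 1)‖ ^ 2) (by linarith [hsn n]) (sq_nonneg _)
      (hc2 n hn) (hp0 n hn.le) (hpA n hn.le) hq0 hq1 (by rwa [← e]) (hz2 n hn)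
      (by rw [← e]; exact hp n hn)
    rw [← e] at h
    linarith [hlog n]
  have hsmono : Monotone s := monotone_nat_of_le_succ fun n => by
    rw [hs]; linarith [sq_nonneg ‖c (n + 1)‖]
  have hphase : ∀ S ≤ T, ∀ q, 0 ≤ q → q ≤ 1 → q ≤ 40 / √(1 + s S) → ∀ n ≤ S,
      ∑ t ∈ Finset.Icc 1 n, p t * z t + (p (n + 1) - q) ^ 2 * (1 + s n) / 80 ≤
        q * ∑ t ∈ Finset.Icc 1 n, z t + 1 / 80 + 285 / 4 * Real.log (1 + s n) := by
    intro S hS q hq0 hq1 hqS n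
    induction n with
    | zero =>
      intro _
      simp only [zero_add, hp1, hs0]
      norm_num
      nlinarith
    | succ n ih =>
      intro hn
      have ih := ih (by omega)
      rw [Finset.sum_Icc_succ_top (by omega), Finset.sum_Icc_succ_top (by omega)]
      have hle : 40 / √(1 + s S) ≤ 40 / √(1 + s (n + 1)) := by
        have : 0 < √(1 + s (n + 1)) := Real.sqrt_pos.2 (by linarith [hsn (n + 1)])
        have := Real.sqrt_le_sqrt (add_le_add_right (hsmono hn) 1)
        gcongr
      have := hogd n (by omega) q hq0 hq1 (hqS.trans hle)
      linarith
  have hsumz : ∀ n, ∑ t ∈ Finset.Icc 1 n, z t =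
      -(1 / 4 * s n) - ∑ t ∈ Finset.Icc 1 n, ⟪c t, x t⟫ := by
    intro n
    induction n with
    | zero => simp [hs0]
    | succ n ih =>
      rw [Finset.sum_Icc_succ_top (by omega), Finset.sum_Icc_succ_top (by omega), ih, hz, hs]
      ring
  classical
  set S := Nat.findGreatest (fun n => 1 + s n ≤ 64 ∨ ‖C n‖ ≤ (1 + s n) / 8) T with hSdef
  have hST : S ≤ T := Nat.findGreatest_le T
  have hSprop : 1 + s S ≤ 64 ∨ ‖C S‖ ≤ (1 + s S) / 8 :=
    Nat.findGreatest_spec (P := fun n => 1 + s n ≤ 64 ∨ ‖C n‖ ≤ (1 + s n) / 8) (Nat.zero_le T)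
      (Or.inl (by norm_num [hs0]))
  have hSmax : ∀ n, S < n → n ≤ T → 64 < 1 + s n ∧ (1 + s n) / 8 < ‖C n‖ := by
    intro n h1 h2
    have := Nat.findGreatest_is_greatest h1 h2
    push Not at this
    exact this
  have hreg := ftrl_regret hs0 hC hs hsn hc hx hx1 hmin S hST
  have hrpos : 0 < √(1 + s S) := Real.sqrt_pos.2 (by linarith [hsn S])
  have hrsq : √(1 + s S) ^ 2 = 1 + s S := Real.sq_sqrt (by linarith [hsn S])
  have hstart : ∑ t ∈ Finset.Icc 1 S, ⟪c t, x t⟫ + ∑ t ∈ Finset.Icc 1 S, p t * z t + ‖C S‖ ≤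
      20 + 1 / 80 + 285 / 4 * Real.log (1 + s S) := by
    rcases hSprop with h64 | hsmall
    · have h := hphase S hST 0 le_rfl zero_le_one (by positivity) S le_rfl
      have : √(1 + s S) ≤ 8 := Real.sqrt_le_iff.2 ⟨by norm_num, by linarith⟩
      have : 0 ≤ (p (S + 1) - 0) ^ 2 * (1 + s S) / 80 := by
        have := hsn S
        positivity
      linarith
    · rcases le_total (√(1 + s S)) 40 with hr | hr
      · have h := hphase S hST 1 zero_le_one le_rfl (by rwa [one_le_div hrpos]) S le_rfl
        rw [hsumz] at h
        have : 0 ≤ (p (S + 1) - 1) ^ 2 * (1 + s S) / 80 := by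
          have := hsn S
          positivity
        linarith [hsn S]
      · set q := 40 / √(1 + s S) with hq
        have hq1 : q ≤ 1 := by rwa [hq, div_le_one hrpos]
        have hq0 : 0 ≤ q := by positivity
        have hqr : q * √(1 + s S) = 40 := by rw [hq]; field_simp
        have h := hphase S hST q hq0 hq1 le_rfl S le_rfl
        rw [hsumz] at h
        have : 0 ≤ (p (S + 1) - q) ^ 2 * (1 + s S) / 80 := by
          have := hsn S
          positivity
        have h1 := mul_le_mul_of_nonneg_left hreg (sub_nonneg.2 hq1)
        have h2 := mul_le_mul_of_nonneg_left hsmall hq0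
        have h3 : q * (1 + s S) = 40 * √(1 + s S) := by
          nth_rw 1 [← hrsq, ← hqr]
          ring
        nlinarith
  have hPhi : p (S + 1) ^ 2 * (1 + s S) / 80 ≤ 20 := by linarith [hpA S hST]
  have htail : ∀ n, S + 1 ≤ n → n ≤ T →
      ∑ t ∈ Finset.Icc 1 n, ⟪c t, x t⟫ + ∑ t ∈ Finset.Icc 1 n, p t * z t + ‖C n‖ +
        p (n + 1) ^ 2 * (1 + s n) / 80 ≤ 43 + 317 / 4 * Real.log (1 + s n) := by
    intro n hn
    induction n, hn using Nat.le_induction with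
    | base =>
      intro hn
      rw [Finset.sum_Icc_succ_top (by omega), Finset.sum_Icc_succ_top (by omega)]
      have h := hogd S (by omega) 0 le_rfl zero_le_one (by positivity)
      have h1 := le_of_abs_le (hcx S (by omega))
      have h2 := hc S (by omega)
      have h3 : ‖C (S + 1)‖ ≤ ‖C S‖ + ‖c (S + 1)‖ := by rw [hC]; exact norm_add_le _ _
      have h4 : 0 ≤ Real.log (1 + s (S + 1)) := Real.log_nonneg (by linarith [hsn (S + 1)])
      simp only [sub_zero, zero_mul, zero_add] at h
      linarith
    | succ n hn ih =>
      intro hnT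
      have ih := ih (by omega)
      rw [Finset.sum_Icc_succ_top (by omega), Finset.sum_Icc_succ_top (by omega)]
      have h := hogd n (by omega) 0 le_rfl zero_le_one (by positivity)
      simp only [sub_zero, zero_mul, zero_add] at h
      obtain ⟨hA, hCn⟩ := hSmax n (by omega) (by omega)
      have hCpos : 0 < ‖C n‖ := by linarith
      have hrC : √(1 + s n) ≤ ‖C n‖ := Real.sqrt_le_iff.2 ⟨hCpos.le, by nlinarith⟩
      have hxn := ftrl_eq_neg_normalized hCpos hrC (hx n (by omega)) (hmin n (by omega))
      have hin : ⟪c (n + 1), x (n + 1)⟫ = -(‖C n‖⁻¹ * ⟪c (n + 1), C n⟫) := by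
        rw [hxn, inner_neg_right, inner_smul_right]
      have hnorm := norm_add_le_of_pos (c := c (n + 1)) hCpos
      rw [← hC] at hnorm
      have hbound : ‖c (n + 1)‖ ^ 2 / (2 * ‖C n‖) ≤
          8 * (‖c (n + 1)‖ ^ 2 / (1 + s (n + 1))) := by
        have hle : (1 + s (n + 1)) ≤ 8 * (2 * ‖C n‖) := by
          rw [hs]; linarith [hc2 n (by omega)]
        have hp : 0 < 1 + s (n + 1) := by linarith [hsn (n + 1)]
        rw [← mul_div_assoc, div_le_div_iff₀ (by positivity) hp]
        nlinarith [mul_le_mul_of_nonneg_left hle (sq_nonneg ‖c (n + 1)‖)]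
      have hl := hlog n
      linarith
  rcases hST.lt_or_eq with hlt | heq
  · have h := htail T hlt le_rfl
    have : 0 ≤ p (T + 1) ^ 2 * (1 + s T) / 80 := by
      have := hsn T
      positivity
    linarith
  · rw [← heq]
    have : 0 ≤ Real.log (1 + s S) := Real.log_nonneg (by linarith [hsn S])
    linarith

end Regret

/-- Theorem 4.2 (optimistic bound): with `α = 1/4` and
`𝓑 = {t : ⟨c_t,h_t⟩ < ‖c_t‖²/4}`, the hint-querying algorithm has expected regret at most
`312 + 152 log(1+σ_{1:T}) + 80(1+√(log(1+σ_{1:T})))·√(Σ_{t∈𝓑}‖c_t−h_t‖²)` and expected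
query cost at most `20·√(σ_{1:T})`. -/
theorem stmt6 {d T : ℕ}
    (c h x : ℕ → Vec d)
    (hc : ∀ t ∈ Finset.Icc 1 T, ‖c t‖ ≤ 1)
    (hh : ∀ t ∈ Finset.Icc 1 T, ‖h t‖ ≤ 1)
    (hx1 : x 1 = 0)
    (hxball : ∀ t ∈ Finset.Icc 1 T, ‖x (t + 1)‖ ≤ 1)
    (hxmin : ∀ t ∈ Finset.Icc 1 T, ∀ y : Vec d, ‖y‖ ≤ 1 →
      ⟪(∑ s ∈ Finset.Icc 1 t, c s), x (t + 1)⟫ +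
          Real.sqrt (1 + ∑ s ∈ Finset.Icc 1 t, ‖c s‖ ^ 2) / 2 * ‖x (t + 1)‖ ^ 2 ≤
        ⟪(∑ s ∈ Finset.Icc 1 t, c s), y⟫ +
          Real.sqrt (1 + ∑ s ∈ Finset.Icc 1 t, ‖c s‖ ^ 2) / 2 * ‖y‖ ^ 2)
    (z : ℕ → ℝ)
    (hz : ∀ t, z t = -((1 / 4) * ‖c t‖ ^ 2) - ⟪c t, x t⟫)
    (p : ℕ → ℝ) (hp1 : p 1 = 0)
    (hp : ∀ t ∈ Finset.Icc 1 T,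
      p (t + 1) =
        max 0 (min (min 1 (40 / Real.sqrt (1 + ∑ s ∈ Finset.Icc 1 t, ‖c s‖ ^ 2)))
          (p t - 40 / (1 + ∑ s ∈ Finset.Icc 1 t, ‖c s‖ ^ 2) * z t)))
    (B : Finset ℕ)
    (hB : B = (Finset.Icc 1 T).filter fun t => ⟪c t, h t⟫ < ‖c t‖ ^ 2 / 4) :
    (∀ u : Vec d, ‖u‖ ≤ 1 →
        ∑ t ∈ Finset.Icc 1 T,
            (p t * ⟪c t, -h t⟫ + (1 - p t) * ⟪c t, x t⟫ - ⟪c t, u⟫) ≤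
          312 + 152 * Real.log (1 + ∑ s ∈ Finset.Icc 1 T, ‖c s‖ ^ 2) +
            80 * (1 + Real.sqrt (Real.log (1 + ∑ s ∈ Finset.Icc 1 T, ‖c s‖ ^ 2))) *
              Real.sqrt (∑ t ∈ B, ‖c t - h t‖ ^ 2)) ∧
      ∑ t ∈ Finset.Icc 1 T, p t * ((1 / 4) * ‖c t‖ ^ 2) ≤
        20 * Real.sqrt (∑ s ∈ Finset.Icc 1 T, ‖c s‖ ^ 2) := by
  set s : ℕ → ℝ := fun n => ∑ t ∈ Finset.Icc 1 n, ‖c t‖ ^ 2 with hsdef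
  set C : ℕ → Vec d := fun n => ∑ t ∈ Finset.Icc 1 n, c t with hCdef
  have hs0 : s 0 = 0 := by simp [hsdef]
  have hC0 : C 0 = 0 := by simp [hCdef]
  have hs : ∀ n, s (n + 1) = s n + ‖c (n + 1)‖ ^ 2 := fun n =>
    Finset.sum_Icc_succ_top (by omega) _
  have hC : ∀ n, C (n + 1) = C n + c (n + 1) := fun n => Finset.sum_Icc_succ_top (by omega) _
  have hsn : ∀ n, 0 ≤ s n := fun n => Finset.sum_nonneg fun t _ => sq_nonneg _
  have hc' : ∀ n < T, ‖c (n + 1)‖ ≤ 1 := fun n hn =>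
    hc _ (Finset.mem_Icc.2 ⟨by omega, by omega⟩)
  have hx' : ∀ n ≤ T, ‖x (n + 1)‖ ≤ 1 := by
    rintro (_ | n) hn
    · simp [hx1]
    · exact hxball _ (Finset.mem_Icc.2 ⟨by omega, hn⟩)
  have hmin : ∀ n ≤ T, ∀ y : Vec d, ‖y‖ ≤ 1 →
      ⟪C n, x (n + 1)⟫ + √(1 + s n) / 2 * ‖x (n + 1)‖ ^ 2 ≤
        ⟪C n, y⟫ + √(1 + s n) / 2 * ‖y‖ ^ 2 := by
    rintro (_ | n) hn y hy
    · simp only [hC0, hs0, zero_add, hx1, inner_zero_left, norm_zero]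
      norm_num
    · exact hxmin _ (Finset.mem_Icc.2 ⟨by omega, hn⟩) y hy
  have hp' : ∀ n < T, p (n + 1 + 1) = max 0 (min (min 1 (40 / √(1 + s (n + 1))))
      (p (n + 1) - 40 / (1 + s (n + 1)) * z (n + 1))) := fun n hn =>
    hp _ (Finset.mem_Icc.2 ⟨by omega, by omega⟩)
  have hp0 : ∀ n ≤ T, 0 ≤ p (n + 1) := by
    rintro (_ | n) hn
    · simp [hp1]
    · rw [hp' n (by omega)]
      exact le_max_left _ _
  have hpr : ∀ n ≤ T, p (n + 1) ≤ 40 / √(1 + s n) := by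
    rintro (_ | n) hn
    · simp [hp1, hs0]
    · rw [hp' n (by omega)]
      exact max_le (by positivity) ((min_le_left _ _).trans (min_le_right _ _))
  have hpA : ∀ n ≤ T, p (n + 1) ^ 2 * (1 + s n) ≤ 1600 := by
    intro n hn
    have hpos : 0 < √(1 + s n) := Real.sqrt_pos.2 (by linarith [hsn n])
    have h2 := pow_le_pow_left₀ (mul_nonneg (hp0 n hn) hpos.le)
      ((le_div_iff₀ hpos).1 (hpr n hn)) 2
    rw [mul_pow, Real.sq_sqrt (by linarith [hsn n])] at h2
    linarith
  have hc2 : ∀ n < T, ‖c (n + 1)‖ ^ 2 ≤ 1 := fun n hn => by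
    nlinarith [hc' n hn, norm_nonneg (c (n + 1))]
  have hlogn : 0 ≤ Real.log (1 + s T) := Real.log_nonneg (by linarith [hsn T])
  refine ⟨fun u hu => ?_, ?_⟩
  · have hmain := surrogate_regret_le hs0 hC hs hsn hc' hx' hx1 hmin hz hp1 hp0 hpA hp'
    have hpt : ∀ t ∈ Finset.Icc 1 T, 0 ≤ p t := by
      intro t ht
      obtain ⟨h1, h2⟩ := Finset.mem_Icc.1 ht
      obtain ⟨n, rfl⟩ := Nat.exists_eq_add_of_le' h1
      exact hp0 n (by omega)
    have hCu : -⟪C T, u⟫ ≤ ‖C T‖ :=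
      (neg_le_abs _).trans ((abs_real_inner_le_norm _ _).trans
        (mul_le_of_le_one_right (norm_nonneg _) hu))
    have hsplit : ∑ t ∈ Finset.Icc 1 T,
        (p t * ⟪c t, -h t⟫ + (1 - p t) * ⟪c t, x t⟫ - ⟪c t, u⟫) =
        ∑ t ∈ Finset.Icc 1 T, ⟪c t, x t⟫ + ∑ t ∈ Finset.Icc 1 T, p t * z t - ⟪C T, u⟫ +
          ∑ t ∈ Finset.Icc 1 T, p t * (‖c t‖ ^ 2 / 4 - ⟪c t, h t⟫) := by
      rw [hCdef, sum_inner, ← Finset.sum_add_distrib, ← Finset.sum_sub_distrib,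
        ← Finset.sum_add_distrib]
      refine Finset.sum_congr rfl fun t _ => ?_
      rw [hz, inner_neg_right]
      ring
    have hBsub : B ⊆ Finset.Icc 1 T := hB ▸ Finset.filter_subset _ _
    have hbad : ∑ t ∈ Finset.Icc 1 T, p t * (‖c t‖ ^ 2 / 4 - ⟪c t, h t⟫) ≤
        ∑ t ∈ B, (p t * ‖c t‖) * ‖c t - h t‖ := by
      rw [← Finset.sum_sdiff hBsub]
      have h1 : ∑ t ∈ Finset.Icc 1 T \ B, p t * (‖c t‖ ^ 2 / 4 - ⟪c t, h t⟫) ≤ 0 := by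
        refine Finset.sum_nonpos fun t ht => ?_
        obtain ⟨ht1, ht2⟩ := Finset.mem_sdiff.1 ht
        rw [hB, Finset.mem_filter, not_and, not_lt] at ht2
        exact mul_nonpos_of_nonneg_of_nonpos (hpt t ht1) (by linarith [ht2 ht1])
      have h2 : ∑ t ∈ B, p t * (‖c t‖ ^ 2 / 4 - ⟪c t, h t⟫) ≤
          ∑ t ∈ B, (p t * ‖c t‖) * ‖c t - h t‖ := by
        refine Finset.sum_le_sum fun t ht => ?_
        rw [mul_assoc]
        refine mul_le_mul_of_nonneg_left ?_ (hpt t (hBsub ht))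
        have := real_inner_le_norm (c t) (c t - h t)
        rw [inner_sub_right, real_inner_self_eq_norm_sq] at this
        nlinarith [sq_nonneg ‖c t‖]
      linarith
    have hcs : ∑ t ∈ B, (p t * ‖c t‖) * ‖c t - h t‖ ≤
        √(∑ t ∈ B, (p t * ‖c t‖) ^ 2) * √(∑ t ∈ B, ‖c t - h t‖ ^ 2) :=
      Real.sum_mul_le_sqrt_mul_sqrt _ _ _
    have hsum : ∀ n ≤ T, ∑ t ∈ Finset.Icc 1 n, (p t * ‖c t‖) ^ 2 ≤
        3200 * Real.log (1 + s n) := by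
      intro n
      induction n with
      | zero => simp [hs0]
      | succ n ih =>
        intro hn
        rw [Finset.sum_Icc_succ_top (by omega)]
        have ih := ih (by omega)
        have hl := div_add_le_log_sub_log (A := 1 + s n) (by linarith [hsn n])
          (sq_nonneg ‖c (n + 1)‖)
        rw [add_assoc, ← hs] at hl
        have hstep : (p (n + 1) * ‖c (n + 1)‖) ^ 2 ≤
            3200 * (‖c (n + 1)‖ ^ 2 / (1 + s (n + 1))) := by
          rw [← mul_div_assoc, le_div_iff₀ (by linarith [hsn (n + 1)])]
          have h1 : p (n + 1) ^ 2 * (1 + s (n + 1)) ≤ 3200 := by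
            rw [hs]
            nlinarith [hpA n (by omega), hsn n, mul_nonneg (sq_nonneg (p (n + 1)))
              (show 0 ≤ 1 + s n - ‖c (n + 1)‖ ^ 2 by linarith [hsn n, hc2 n (by omega)])]
          nlinarith [mul_le_mul_of_nonneg_left h1 (sq_nonneg ‖c (n + 1)‖)]
        linarith
    have hroot : √(∑ t ∈ B, (p t * ‖c t‖) ^ 2) ≤ 80 * (1 + √(Real.log (1 + s T))) := by
      refine Real.sqrt_le_iff.2 ⟨by positivity, ?_⟩
      have h1 := Finset.sum_le_sum_of_subset_of_nonneg (f := fun t => (p t * ‖c t‖) ^ 2) hBsub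
        fun t _ _ => sq_nonneg _
      have h2 := hsum T le_rfl
      nlinarith [Real.sq_sqrt hlogn, Real.sqrt_nonneg (Real.log (1 + s T))]
    have := mul_le_mul_of_nonneg_right hroot (Real.sqrt_nonneg (∑ t ∈ B, ‖c t - h t‖ ^ 2))
    rw [hsplit]
    linarith
  · suffices hq : ∀ n ≤ T, ∑ t ∈ Finset.Icc 1 n, p t * ((1 / 4) * ‖c t‖ ^ 2) ≤ 20 * √(s n) from
      hq T le_rfl
    intro n
    induction n with
    | zero => simp [hs0]
    | succ n ih =>
      intro hn
      rw [Finset.sum_Icc_succ_top (by omega)]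
      have ih := ih (by omega)
      have hd := div_sqrt_one_add_le (hsn n) (sq_nonneg ‖c (n + 1)‖) (hc2 n (by omega))
      rw [← hs] at hd
      have h1 := mul_le_mul_of_nonneg_right (hpr n (by omega)) (sq_nonneg ‖c (n + 1)‖)
      have h2 : 40 / √(1 + s n) * ‖c (n + 1)‖ ^ 2 = 40 * (‖c (n + 1)‖ ^ 2 / √(1 + s n)) := by
        ring
      linarith
end
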